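/- Let i, j, k be integers and set α = aⁱ b fᵏ in the group G_STK = ⟨a, b, f ∣ b a b⁻¹ = a⁻¹, b f b⁻¹ = f⁻¹, a f = f a⟩. Then α² = b², α^{2j+1} = aⁱ b^{2j+1} fᵏ, the element α has infinite order, and the centralizer of aⁱ b^{2j+1} fᵏ in G_STK is the infinite cyclic subgroup generated by α. -/

import Mathlib

/-- The relators of the presentation
`⟨a, b, f ∣ b a b⁻¹ = a⁻¹, b f b⁻¹ = f⁻¹, a f = f a⟩`, with `a, b, f` the generators
`0, 1, 2`. -/
def stkRels : Set (FreeGroup (Fin 3)) :=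
  {FreeGroup.of 1 * FreeGroup.of 0 * (FreeGroup.of 1)⁻¹ * FreeGroup.of 0,
   FreeGroup.of 1 * FreeGroup.of 2 * (FreeGroup.of 1)⁻¹ * FreeGroup.of 2,
   FreeGroup.of 0 * FreeGroup.of 2 * (FreeGroup.of 0)⁻¹ * (FreeGroup.of 2)⁻¹}

/-- The group `G_STK = ⟨a, b, f ∣ b a b⁻¹ = a⁻¹, b f b⁻¹ = f⁻¹, a f = f a⟩`. -/
abbrev GSTK : Type := PresentedGroup stkRels

namespace GSTK

/-- The generator `a` of `G_STK`. -/
def a : GSTK := PresentedGroup.of 0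

/-- The generator `b` of `G_STK`. -/
def b : GSTK := PresentedGroup.of 1

/-- The generator `f` of `G_STK`. -/
def f : GSTK := PresentedGroup.of 2

end GSTK

namespace GSTK

lemma b_semiconjBy_a : SemiconjBy b a a⁻¹ := by
  have h : b * a * b⁻¹ * a = 1 :=
    PresentedGroup.one_of_mem (rels := stkRels) (Or.inl rfl)
  exact mul_inv_eq_iff_eq_mul.mp (eq_inv_of_mul_eq_one_left h)

lemma b_semiconjBy_f : SemiconjBy b f f⁻¹ := by
  have h : b * f * b⁻¹ * f = 1 :=
    PresentedGroup.one_of_mem (rels := stkRels) (Or.inr (Or.inl rfl))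
  exact mul_inv_eq_iff_eq_mul.mp (eq_inv_of_mul_eq_one_left h)

lemma commute_a_f : Commute a f := by
  have h : a * f * a⁻¹ * f⁻¹ = 1 :=
    PresentedGroup.one_of_mem (rels := stkRels) (Or.inr (Or.inr rfl))
  exact commutatorElement_eq_one_iff_mul_comm.mp h

lemma b_mul_a_zpow (p : ℤ) : b * a ^ p = a ^ (-p) * b := by
  have h := (b_semiconjBy_a.zpow_right p).eq
  rwa [inv_zpow'] at h

lemma b_mul_f_zpow (r : ℤ) : b * f ^ r = f ^ (-r) * b := by
  have h := (b_semiconjBy_f.zpow_right r).eq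
  rwa [inv_zpow'] at h

lemma f_zpow_mul_b (r : ℤ) : f ^ r * b = b * f ^ (-r) := by
  rw [b_mul_f_zpow, neg_neg]

lemma b_inv_mul_a_zpow (p : ℤ) : b⁻¹ * a ^ p = a ^ (-p) * b⁻¹ := by
  rw [inv_mul_eq_iff_eq_mul, ← mul_assoc, b_mul_a_zpow, neg_neg, mul_inv_cancel_right]

lemma b_inv_mul_f_zpow (r : ℤ) : b⁻¹ * f ^ r = f ^ (-r) * b⁻¹ := by
  rw [inv_mul_eq_iff_eq_mul, ← mul_assoc, b_mul_f_zpow, neg_neg, mul_inv_cancel_right]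

lemma commute_b_sq_a_zpow (p : ℤ) : Commute (b ^ 2) (a ^ p) := by
  rw [commute_iff_eq, pow_two, mul_assoc, b_mul_a_zpow, ← mul_assoc, b_mul_a_zpow, neg_neg,
    mul_assoc]

/-- Every element of `G_STK` has the form `a ^ p * f ^ r * b ^ q`. -/
lemma exists_normal_form (g : GSTK) : ∃ p r q : ℤ, g = a ^ p * f ^ r * b ^ q := by
  have hg : g ∈ Subgroup.closure (Set.range (PresentedGroup.of (rels := stkRels))) := by
    rw [PresentedGroup.closure_range_of]; trivial
  have haf (p r : ℤ) : f ^ r * a ^ p = a ^ p * f ^ r :=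
    (commute_a_f.zpow_zpow p r).eq.symm
  induction hg using Subgroup.closure_induction_left with
  | one => exact ⟨0, 0, 0, by simp⟩
  | mul_left x hx y _ ih =>
    obtain ⟨p, r, q, rfl⟩ := ih
    obtain ⟨n, rfl⟩ := hx
    fin_cases n
    · exact ⟨1 + p, r, q, by
        change a * _ = _
        simp only [zpow_add, zpow_one, mul_assoc]⟩
    · exact ⟨-p, -r, 1 + q, by
        change b * _ = _
        rw [← mul_assoc, ← mul_assoc, b_mul_a_zpow, mul_assoc (a ^ (-p)), b_mul_f_zpow, zpow_add,
          zpow_one]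
        simp only [mul_assoc]⟩
    · exact ⟨p, 1 + r, q, by
        change f * _ = _
        rw [← mul_assoc, ← mul_assoc, ← zpow_one f, haf, zpow_one, zpow_add, zpow_one]
        simp only [mul_assoc]⟩
  | inv_mul_cancel x hx y _ ih =>
    obtain ⟨p, r, q, rfl⟩ := ih
    obtain ⟨n, rfl⟩ := hx
    fin_cases n
    · exact ⟨-1 + p, r, q, by
        change a⁻¹ * _ = _
        simp only [zpow_add, zpow_neg, zpow_one, mul_assoc]⟩
    · exact ⟨-p, -r, -1 + q, by
        change b⁻¹ * _ = _
        rw [← mul_assoc, ← mul_assoc, b_inv_mul_a_zpow, mul_assoc (a ^ (-p)), b_inv_mul_f_zpow,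
          zpow_add, zpow_neg_one]
        simp only [mul_assoc]⟩
    · exact ⟨p, -1 + r, q, by
        change f⁻¹ * _ = _
        rw [← mul_assoc, ← mul_assoc, ← zpow_neg_one f, haf, zpow_add]
        simp only [mul_assoc]⟩

/-- The permutation of the normal forms `(p, r, q)` induced by left multiplication by `a`. -/
def permA : Equiv.Perm (ℤ × ℤ × ℤ) where
  toFun x := (x.1 + 1, x.2.1, x.2.2)
  invFun x := (x.1 - 1, x.2.1, x.2.2)
  left_inv x := by simp
  right_inv x := by simp

/-- The permutation of the normal forms `(p, r, q)` induced by left multiplication by `b`. -/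
def permB : Equiv.Perm (ℤ × ℤ × ℤ) where
  toFun x := (-x.1, -x.2.1, x.2.2 + 1)
  invFun x := (-x.1, -x.2.1, x.2.2 - 1)
  left_inv x := by simp
  right_inv x := by simp

/-- The permutation of the normal forms `(p, r, q)` induced by left multiplication by `f`. -/
def permF : Equiv.Perm (ℤ × ℤ × ℤ) where
  toFun x := (x.1, x.2.1 + 1, x.2.2)
  invFun x := (x.1, x.2.1 - 1, x.2.2)
  left_inv x := by simp
  right_inv x := by simp

/-- The action of `G_STK` on the normal forms by left multiplication. -/
def toPerm : GSTK →* Equiv.Perm (ℤ × ℤ × ℤ) :=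
  PresentedGroup.toGroup (f := ![permA, permB, permF]) (by
    rintro r (rfl | rfl | rfl) <;> ext x <;>
      simp [permA, permB, permF, Equiv.Perm.inv_def, Equiv.symm])

@[simp] lemma toPerm_a : toPerm a = permA := PresentedGroup.toGroup.of _

@[simp] lemma toPerm_b : toPerm b = permB := PresentedGroup.toGroup.of _

@[simp] lemma toPerm_f : toPerm f = permF := PresentedGroup.toGroup.of _

lemma permA_zpow (n : ℤ) (x : ℤ × ℤ × ℤ) : (permA ^ n) x = (x.1 + n, x.2.1, x.2.2) := by
  induction n generalizing x with
  | zero => simp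
  | succ n ih => rw [zpow_add_one, Equiv.Perm.mul_apply, ih]; simp [permA]; ring
  | pred n ih =>
    rw [zpow_sub_one, Equiv.Perm.mul_apply, ih]
    simp [permA, Equiv.Perm.inv_def, Equiv.symm]; ring

lemma permF_zpow (n : ℤ) (x : ℤ × ℤ × ℤ) : (permF ^ n) x = (x.1, x.2.1 + n, x.2.2) := by
  induction n generalizing x with
  | zero => simp
  | succ n ih => rw [zpow_add_one, Equiv.Perm.mul_apply, ih]; simp [permF]; ring
  | pred n ih =>
    rw [zpow_sub_one, Equiv.Perm.mul_apply, ih]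
    simp [permF, Equiv.Perm.inv_def, Equiv.symm]; ring

lemma permB_zpow_two_mul (n : ℤ) (x : ℤ × ℤ × ℤ) :
    (permB ^ (2 * n)) x = (x.1, x.2.1, x.2.2 + 2 * n) := by
  have hsq (y : ℤ × ℤ × ℤ) : (permB ^ (2 : ℤ)) y = (y.1, y.2.1, y.2.2 + 2) := by
    rw [zpow_two]; simp [permB]; ring
  have hinv (y : ℤ × ℤ × ℤ) : (permB ^ (2 : ℤ))⁻¹ y = (y.1, y.2.1, y.2.2 - 2) := by
    rw [Equiv.Perm.inv_eq_iff_eq, hsq]; simp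
  rw [zpow_mul]
  induction n generalizing x with
  | zero => simp
  | succ n ih => rw [zpow_add_one, Equiv.Perm.mul_apply, ih, hsq]; simp; ring
  | pred n ih => rw [zpow_sub_one, Equiv.Perm.mul_apply, ih, hinv]; simp; ring

lemma permB_zpow_two_mul_add_one (n : ℤ) (x : ℤ × ℤ × ℤ) :
    (permB ^ (2 * n + 1)) x = (-x.1, -x.2.1, x.2.2 + (2 * n + 1)) := by
  rw [zpow_add_one, Equiv.Perm.mul_apply, permB_zpow_two_mul]; simp [permB]; ring

lemma alpha_sq (i k : ℤ) : (a ^ i * b * f ^ k) ^ 2 = b ^ 2 := by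
  have h : f ^ k * a ^ i = a ^ i * f ^ k := (commute_a_f.zpow_zpow i k).eq.symm
  calc (a ^ i * b * f ^ k) ^ 2 = a ^ i * b * (f ^ k * a ^ i) * b * f ^ k := by
        simp only [pow_two, mul_assoc]
    _ = a ^ i * (b * a ^ i) * (f ^ k * b) * f ^ k := by simp only [h, mul_assoc]
    _ = b ^ 2 := by rw [b_mul_a_zpow, f_zpow_mul_b, pow_two]; group

lemma alpha_zpow_two_mul (i k n : ℤ) : (a ^ i * b * f ^ k) ^ (2 * n) = b ^ (2 * n) := by
  rw [zpow_mul, zpow_mul, zpow_ofNat, zpow_ofNat, alpha_sq]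

lemma alpha_zpow_odd (i k n : ℤ) :
    (a ^ i * b * f ^ k) ^ (2 * n + 1) = a ^ i * b ^ (2 * n + 1) * f ^ k := by
  have h : b ^ (2 * n) * a ^ i = a ^ i * b ^ (2 * n) := by
    rw [zpow_mul, zpow_ofNat]; exact ((commute_b_sq_a_zpow i).zpow_left n).eq
  rw [zpow_add_one, alpha_zpow_two_mul, ← mul_assoc, ← mul_assoc, h, zpow_add_one]
  simp only [mul_assoc]

lemma f_zpow_neg_mul_b_zpow_odd (k n : ℤ) :
    f ^ (-k) * b ^ (2 * n + 1) = b ^ (2 * n + 1) * f ^ k := by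
  have h : b * f ^ k * b ^ (2 * n) = b ^ (2 * n + 1) * f ^ k := by
    have h := alpha_zpow_odd 0 k n
    rw [add_comm, zpow_one_add, alpha_zpow_two_mul] at h
    simpa [add_comm] using h
  rw [← h, b_mul_f_zpow, add_comm, zpow_one_add, mul_assoc]

lemma not_isOfFinOrder_alpha (i k : ℤ) : ¬ IsOfFinOrder (a ^ i * b * f ^ k) := by
  rw [isOfFinOrder_iff_pow_eq_one]
  rintro ⟨n, hn, h⟩
  have hb : b ^ (2 * (n : ℤ)) = 1 := by
    rw [← alpha_zpow_two_mul i k, mul_comm, zpow_mul, zpow_natCast, h, one_zpow]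
  have h0 := congrArg (fun g => (toPerm g 0).2.2) hb
  simp [map_zpow, permB_zpow_two_mul] at h0
  omega

end GSTK

/-!
STATEMENT 7: For integers `i, j, k`, set `α = aⁱ b fᵏ` in `G_STK`.  Then `α² = b²`,
`α^(2j+1) = aⁱ b^(2j+1) fᵏ`, `α` has infinite order, and the centralizer of
`aⁱ b^(2j+1) fᵏ` in `G_STK` is the infinite cyclic subgroup generated by `α`.
-/

theorem gstk_centralizer_odd_case (i j k : ℤ) :
    (GSTK.a ^ i * GSTK.b * GSTK.f ^ k) ^ 2 = GSTK.b ^ 2 ∧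
      (GSTK.a ^ i * GSTK.b * GSTK.f ^ k) ^ (2 * j + 1) =
        GSTK.a ^ i * GSTK.b ^ (2 * j + 1) * GSTK.f ^ k ∧
      ¬ IsOfFinOrder (GSTK.a ^ i * GSTK.b * GSTK.f ^ k) ∧
      Subgroup.centralizer {GSTK.a ^ i * GSTK.b ^ (2 * j + 1) * GSTK.f ^ k} =
        Subgroup.zpowers (GSTK.a ^ i * GSTK.b * GSTK.f ^ k) := by
  refine ⟨GSTK.alpha_sq i k, GSTK.alpha_zpow_odd i k j, GSTK.not_isOfFinOrder_alpha i k, ?_⟩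
  ext g
  rw [Subgroup.mem_centralizer_singleton_iff, Subgroup.mem_zpowers_iff]
  constructor
  · intro hg
    obtain ⟨p, r, q, rfl⟩ := GSTK.exists_normal_form g
    have h0 := congrArg (fun g => GSTK.toPerm g 0) hg
    refine ⟨q, ?_⟩
    obtain ⟨n, rfl | rfl⟩ := q.even_or_odd'
    · simp [map_zpow, GSTK.permA_zpow, GSTK.permF_zpow, GSTK.permB_zpow_two_mul,
        GSTK.permB_zpow_two_mul_add_one] at h0
      obtain rfl : p = 0 := by omega
      obtain rfl : r = 0 := by omega
      simp [GSTK.alpha_zpow_two_mul]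
    · simp [map_zpow, GSTK.permA_zpow, GSTK.permF_zpow, GSTK.permB_zpow_two_mul_add_one] at h0
      obtain rfl : p = i := by omega
      obtain rfl : r = -k := by omega
      rw [GSTK.alpha_zpow_odd, mul_assoc, mul_assoc, GSTK.f_zpow_neg_mul_b_zpow_odd]
  · rintro ⟨n, rfl⟩
    rw [← GSTK.alpha_zpow_odd]
    exact (Commute.refl _).zpow_zpow n (2 * j + 1)
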